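/- The ideal Circ(B) = ⟨∑_{i=1}^n a_{ij} z_i w_i : j = 1,…,d⟩ ⊂ C[z_1,…,z_n,w_1,…,w_n] is generated by binomials (after a suitable choice of generators, equivalently the row space of A has a basis of vectors with at most two nonzero entries each) if and only if the Gale dual vectors b_1,…,b_n ∈ Z^{n−d} lie on n−d linearly independent lines through the origin in R^{n−d}. -/

import Mathlib

open MvPolynomial

namespace GaleCircuit

/-- A short exact sequence of integer matrices splits. -/
lemma exists_splitting {m n e : Type*} [Fintype m] [Fintype n] [Fintype e]
    [DecidableEq m] [DecidableEq n] [DecidableEq e]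
    (A : Matrix m n ℤ) (B : Matrix n e ℤ)
    (hA : Function.Surjective A.mulVec)
    (hcomp : ∀ c : e → ℤ, A.mulVec (B.mulVec c) = 0)
    (hker : ∀ v : n → ℤ, A.mulVec v = 0 → ∃! c : e → ℤ, B.mulVec c = v) :
    ∃ (S : Matrix n m ℤ) (T : Matrix e n ℤ), S * A + B * T = 1 ∧ T * B = 1 ∧ A * B = 0 := by
  have hAB : A * B = 0 := by
    apply Matrix.ext_of_mulVec_single
    intro i
    rw [← Matrix.mulVec_mulVec, hcomp, Matrix.zero_mulVec]
  choose s hs using hA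
  let S : Matrix n m ℤ := Matrix.of fun i j => s (Pi.single j 1) i
  have hS : A * S = 1 := by
    apply Matrix.ext_of_mulVec_single
    intro j
    rw [← Matrix.mulVec_mulVec, Matrix.one_mulVec, Matrix.mulVec_single_one]
    exact hs _
  have hT (i : n) : A.mulVec ((1 - S * A).mulVec (Pi.single i 1)) = 0 := by
    rw [Matrix.mulVec_mulVec, Matrix.mul_sub, ← Matrix.mul_assoc, hS]
    rw [Matrix.mul_one, Matrix.one_mul, sub_self, Matrix.zero_mulVec]
  choose t ht using fun i => (hker _ (hT i)).exists
  let T : Matrix e n ℤ := Matrix.of fun k i => t i k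
  have hBT : B * T = 1 - S * A := by
    apply Matrix.ext_of_mulVec_single
    intro i
    rw [← ht i, ← Matrix.mulVec_mulVec, Matrix.mulVec_single_one]
    rfl
  refine ⟨S, T, by rw [hBT]; abel, ?_, hAB⟩
  apply Matrix.ext_of_mulVec_single
  intro k
  have h0 : A.mulVec (B.mulVec (Pi.single k 1)) = 0 := hcomp _
  refine (hker _ h0).unique ?_ ?_
  · rw [Matrix.mulVec_mulVec, ← Matrix.mul_assoc, hBT, Matrix.sub_mul, Matrix.mul_assoc, hAB]
    simp
  · rw [Matrix.one_mulVec]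

/-- The left kernel of `B` is the row space of `A`, over any commutative ring. -/
lemma eq_vecMul_of_vecMul_eq_zero {m n e R : Type*} [Fintype m] [Fintype n] [Fintype e]
    [DecidableEq n] [CommRing R]
    {A : Matrix m n ℤ} {B : Matrix n e ℤ} {S : Matrix n m ℤ} {T : Matrix e n ℤ}
    (h : S * A + B * T = 1) {a : n → R}
    (ha : Matrix.vecMul a (B.map (Int.castRingHom R)) = 0) :
    Matrix.vecMul (Matrix.vecMul a (S.map (Int.castRingHom R))) (A.map (Int.castRingHom R))
      = a := by
  have h' := congrArg (fun M => M.map (Int.castRingHom R)) h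
  simp only [Matrix.map_add _ (map_add (Int.castRingHom R)), Matrix.map_mul,
    Matrix.map_one _ (map_zero (Int.castRingHom R)) (map_one (Int.castRingHom R))] at h'
  have h2 := congrArg (Matrix.vecMul a) h'
  rw [Matrix.vecMul_add, ← Matrix.vecMul_vecMul, ← Matrix.vecMul_vecMul, ha,
    Matrix.zero_vecMul, add_zero, Matrix.vecMul_one] at h2
  exact h2

section Polynomial

variable {n : Type*} {K : Type*} [Field K]

/-- The exponent of the monomial `zᵢ wᵢ`. -/
noncomputable def pairExp {n : Type*} (i : n) : n ⊕ n →₀ ℕ :=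
  Finsupp.single (Sum.inl i) 1 + Finsupp.single (Sum.inr i) 1

lemma pairExp_injective : Function.Injective (pairExp (n := n)) := by
  classical
  intro i j h
  have := DFunLike.congr_fun h (Sum.inl i)
  by_contra hij
  simp [pairExp, Ne.symm hij] at this

lemma degree_pairExp (i : n) : (pairExp i).degree = 2 := by
  simp [pairExp, map_add]

lemma C_mul_X_mul_X (c : K) (i : n) :
    (C c * X (Sum.inl i) * X (Sum.inr i) : MvPolynomial (n ⊕ n) K) = monomial (pairExp i) c := by
  rw [X, X, C_mul_monomial, monomial_mul]
  simp [pairExp]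

/-- If `g` has no terms of degree below `2`, then multiplying by `h` scales the terms of degree
at most `2` by the constant term of `h`. -/
lemma coeff_mul_of_degree_le_two {σ : Type*} {g : MvPolynomial σ K}
    (hg : ∀ m : σ →₀ ℕ, m.degree < 2 → coeff m g = 0) (h : MvPolynomial σ K)
    {m : σ →₀ ℕ} (hm : m.degree ≤ 2) : coeff m (h * g) = coeff 0 h * coeff m g := by
  classical
  rw [coeff_mul]
  refine Finset.sum_eq_single (0, m) ?_ (by simp)
  rintro ⟨a, b⟩ hab hne
  rw [Finset.HasAntidiagonal.mem_antidiagonal] at hab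
  simp only at hab ⊢
  have hd : a.degree + b.degree = m.degree := by rw [← map_add, hab]
  rw [hg b, mul_zero]
  by_contra hb
  have ha : a = 0 := by
    rw [← Finsupp.degree_eq_zero_iff]
    omega
  apply hne
  simpa [ha] using hab

/-- The coefficients of the monomials `zᵢ wᵢ` of elements of an ideal generated in degree `≥ 2`
lie in the linear span of those of the generators. -/
lemma coeff_pairExp_mem_of_mem_span {n : Type*} {G : Set (MvPolynomial (n ⊕ n) K)}
    (W : Submodule K (n → K))
    (hlow : ∀ g ∈ G, ∀ m : n ⊕ n →₀ ℕ, m.degree < 2 → coeff m g = 0)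
    (hW : ∀ g ∈ G, (fun i => coeff (pairExp i) g) ∈ W)
    {p : MvPolynomial (n ⊕ n) K} (hp : p ∈ Ideal.span G) :
    (∀ m : n ⊕ n →₀ ℕ, m.degree < 2 → coeff m p = 0) ∧ (fun i => coeff (pairExp i) p) ∈ W := by
  induction hp using Submodule.span_induction with
  | mem g hg => exact ⟨hlow g hg, hW g hg⟩
  | zero => exact ⟨by simp, W.zero_mem⟩
  | add p q _ _ hp hq =>
    refine ⟨fun m hm => by simp [hp.1 m hm, hq.1 m hm], ?_⟩
    simp only [coeff_add]
    exact W.add_mem hp.2 hq.2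
  | smul h p _ hp =>
    refine ⟨fun m hm => ?_, ?_⟩
    · rw [smul_eq_mul, coeff_mul_of_degree_le_two hp.1 h hm.le, hp.1 m hm, mul_zero]
    · convert W.smul_mem (coeff 0 h) hp.2 using 1
      ext i
      rw [smul_eq_mul, coeff_mul_of_degree_le_two hp.1 h (degree_pairExp i).le]
      rfl

/-- The quadric `∑ᵢ aᵢ zᵢ wᵢ`. -/
noncomputable def quadric [Fintype n] (a : n → K) : MvPolynomial (n ⊕ n) K :=
  ∑ i, monomial (pairExp i) (a i)

lemma coeff_quadric_of_degree_lt [Fintype n] (a : n → K) {m : n ⊕ n →₀ ℕ} (hm : m.degree < 2) :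
    coeff m (quadric a) = 0 := by
  classical
  rw [quadric, coeff_sum]
  refine Finset.sum_eq_zero fun i _ => ?_
  rw [coeff_monomial, if_neg]
  rintro rfl
  simp [degree_pairExp] at hm

lemma coeff_pairExp_quadric [Fintype n] (a : n → K) (i : n) :
    coeff (pairExp i) (quadric a) = a i := by
  classical
  simp [quadric, coeff_sum, coeff_monomial, pairExp_injective.eq_iff]

lemma quadric_vecMul [Fintype n] {m : Type*} [Fintype m] (y : m → K) (A : Matrix m n K) :
    quadric (Matrix.vecMul y A) = ∑ j, C (y j) * quadric (A j) := by
  simp only [quadric, Finset.mul_sum, C_mul_monomial, Matrix.vecMul, dotProduct, map_sum]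
  exact Finset.sum_comm

lemma quadric_sub_single [Fintype n] [DecidableEq n] (c c' : K) (i j : n) :
    quadric (Pi.single i c - Pi.single j c') =
      monomial (pairExp i) c - monomial (pairExp j) c' := by
  simp only [quadric, Pi.sub_apply, map_sub, Finset.sum_sub_distrib]
  congr 1
  · rw [Finset.sum_eq_single i] <;> simp +contextual
  · rw [Finset.sum_eq_single j] <;> simp +contextual

end Polynomial

/-- Two rows of `B` are parallel. -/
def rowSetoid {n e : Type*} (B : Matrix n e ℤ) : Setoid n where
  r i j := ∃ c : ℚ, c ≠ 0 ∧ ∀ t, (B i t : ℚ) = c * B j t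
  iseqv :=
    { refl := fun _ => ⟨1, one_ne_zero, fun _ => by simp⟩
      symm := by
        rintro i j ⟨c, hc, h⟩
        exact ⟨c⁻¹, inv_ne_zero hc, fun t => by rw [h]; field_simp⟩
      trans := by
        rintro i j k ⟨c, hc, h⟩ ⟨c', hc', h'⟩
        exact ⟨c * c', mul_ne_zero hc hc', fun t => by rw [h, h', mul_assoc]⟩ }

/-- A linear relation between two nonzero integer rows makes them parallel. -/
lemma rowSetoid_of_relation {n e K : Type*} [Field K] [CharZero K] {B : Matrix n e ℤ} {i j : n}
    (hi : (fun k => B i k) ≠ 0) (hj : (fun k => B j k) ≠ 0) {x y : K} (hx : x ≠ 0)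
    (h : ∀ t, x * B i t + y * B j t = 0) : rowSetoid B i j := by
  obtain ⟨t, ht⟩ := Function.ne_iff.mp hj
  obtain ⟨s, hs⟩ := Function.ne_iff.mp hi
  simp only [Pi.zero_apply] at ht hs
  have hcross (u : e) : B i u * B j t = B i t * B j u := by
    have : x * ((B i u * B j t : ℤ) - (B i t * B j u : ℤ) : K) = 0 := by
      push_cast
      linear_combination (B j t : K) * h u - (B j u : K) * h t
    have := (mul_eq_zero.mp this).resolve_left hx
    exact_mod_cast sub_eq_zero.mp this
  have htQ : (B j t : ℚ) ≠ 0 := by exact_mod_cast ht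
  refine ⟨B i t / B j t, div_ne_zero ?_ htQ, fun u => ?_⟩
  · intro h0
    have h0 : B i t = 0 := by exact_mod_cast h0
    have := hcross s
    rw [h0, zero_mul] at this
    exact (mul_ne_zero hs ht) this
  · field_simp
    exact_mod_cast hcross u

/-- The vectors whose restriction to every parallel class is a relation among the rows of `B`. -/
def classwiseRelations {n e : Type*} [Fintype n] (B : Matrix n e ℤ) (K : Type*) [Field K] :
    Submodule K (n → K) :=
  open scoped Classical in
  { carrier := {a | ∀ q : Quotient (rowSetoid B), ∀ t,
      ∑ i, (if Quotient.mk _ i = q then a i * (B i t : K) else 0) = 0}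
    zero_mem' := by simp
    add_mem' := by
      intro a b ha hb q t
      have h := congrArg₂ (· + ·) (ha q t) (hb q t)
      simp only [← Finset.sum_add_distrib, add_zero] at h
      refine (Finset.sum_congr rfl fun i _ => ?_).trans h
      split_ifs <;> simp [add_mul]
    smul_mem' := by
      intro c a ha q t
      have h := congrArg (c * ·) (ha q t)
      simp only [Finset.mul_sum, mul_zero] at h
      refine (Finset.sum_congr rfl fun i _ => ?_).trans h
      split_ifs <;> simp [mul_assoc] }

/-- A relation among the nonzero rows of `B` with at most two terms is supported in one
parallel class. -/
lemma mem_classwiseRelations {n e K : Type*} [Fintype n] [Fintype e] [Field K] [CharZero K]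
    {B : Matrix n e ℤ} (hrows : ∀ i, (fun k => B i k) ≠ 0) {a : n → K} {s : Finset n}
    (hs : s.card ≤ 2) (has : ∀ i, a i ≠ 0 → i ∈ s)
    (ha : Matrix.vecMul a (B.map (Int.castRingHom K)) = 0) : a ∈ classwiseRelations B K := by
  classical
  intro q t
  have hat (t : e) : ∑ i, a i * (B i t : K) = 0 := by
    simpa [Matrix.vecMul, dotProduct] using congrFun ha t
  by_cases hout : ∀ i, a i ≠ 0 → Quotient.mk (rowSetoid B) i = q
  · refine (Finset.sum_congr rfl fun i _ => ?_).trans (hat t)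
    by_cases h0 : a i = 0
    · simp [h0]
    · rw [if_pos (hout i h0)]
  · push Not at hout
    obtain ⟨j, hj, hjq⟩ := hout
    refine Finset.sum_eq_zero fun i _ => ?_
    split_ifs with hiq
    · by_contra hne
      have hi : a i ≠ 0 := left_ne_zero_of_mul hne
      have hij : i ≠ j := by
        rintro rfl
        exact hjq hiq
      have hsub : ({i, j} : Finset n) = s := by
        apply Finset.eq_of_subset_of_card_le
        · intro k hk
          rcases Finset.mem_insert.mp hk with rfl | hk
          · exact has _ hi
          · rw [Finset.mem_singleton.mp hk]
            exact has _ hj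
        · rw [Finset.card_pair hij]
          exact hs
      have hrel : rowSetoid B i j := by
        refine rowSetoid_of_relation (hrows i) (hrows j) hi (y := a j) fun u => ?_
        rw [← hat u, ← Finset.sum_pair hij (f := fun k => a k * (B k u : K))]
        refine Finset.sum_subset (Finset.subset_univ _) fun k _ hk => ?_
        rw [hsub] at hk
        have : a k = 0 := by
          by_contra h
          exact hk (has k h)
        rw [this, zero_mul]
      exact hjq ((Quotient.sound hrel).symm.trans hiq)
    · rfl

/-- If every row of `A` is classwise a relation, representatives of the parallel classes of rows
of `B` are linearly independent. -/
lemma linearIndependent_row_representatives {m n e : Type*} [Fintype m] [Fintype n] [Fintype e]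
    [DecidableEq n] {K : Type*} [Field K] [CharZero K]
    {A : Matrix m n ℤ} {B : Matrix n e ℤ} {S : Matrix n m ℤ} {T : Matrix e n ℤ}
    (h : S * A + B * T = 1) (hrows : ∀ i, (fun k => B i k) ≠ 0)
    (hAW : ∀ j, (fun i => (A j i : K)) ∈ classwiseRelations B K) :
    LinearIndependent ℚ fun (q : Quotient (rowSetoid B)) (t : e) => (B q.out t : ℚ) := by
  classical
  rw [Fintype.linearIndependent_iff]
  intro x hx q
  let a : n → K := fun i => if (Quotient.mk (rowSetoid B) i).out = i then
    (x (Quotient.mk (rowSetoid B) i) : K) else 0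
  have ha_out (q : Quotient (rowSetoid B)) : a q.out = x q := by
    simp [a]
  have hsum (f : n → K) : ∑ i, a i * f i = ∑ q, (x q : K) * f q.out := by
    rw [← Finset.sum_fiberwise (s := Finset.univ) (g := Quotient.mk (rowSetoid B))]
    refine Finset.sum_congr rfl fun q _ => ?_
    rw [Finset.sum_eq_single q.out]
    · rw [ha_out]
    · intro i hi hne
      simp only [Finset.mem_filter, Finset.mem_univ, true_and] at hi
      simp [a, hi, hne.symm]
    · intro hq
      simp at hq
  have haB : Matrix.vecMul a (B.map (Int.castRingHom K)) = 0 := by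
    ext t
    have hxt := congrFun hx t
    simp only [Finset.sum_apply, Pi.smul_apply, smul_eq_mul, Pi.zero_apply] at hxt
    have hxt' := congrArg (Rat.cast : ℚ → K) hxt
    push_cast at hxt'
    simp only [Matrix.vecMul, dotProduct, Matrix.map_apply, eq_intCast, Pi.zero_apply]
    rw [hsum fun i => (B i t : K)]
    exact hxt'
  have haW : a ∈ classwiseRelations B K := by
    rw [← eq_vecMul_of_vecMul_eq_zero h haB, Matrix.vecMul_eq_sum]
    exact Submodule.sum_mem _ fun j _ => Submodule.smul_mem _ _ (hAW j)
  obtain ⟨t, ht⟩ := Function.ne_iff.mp (hrows q.out)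
  have hq := haW q t
  have hterm : ∑ i, (if Quotient.mk (rowSetoid B) i = q then a i * (B i t : K) else 0) =
      x q * B q.out t := by
    rw [Finset.sum_eq_single q.out]
    · simp [ha_out]
    · intro i _ hne
      split_ifs with hi
      · simp [a, hi, hne.symm]
      · rfl
    · simp
  have hz : (x q : K) * B q.out t = 0 := by
    rw [← hterm]
    convert hq
  have ht' : (B q.out t : K) ≠ 0 := by
    simpa using ht
  exact_mod_cast (mul_eq_zero.mp hz).resolve_right ht'

/-- Representatives of the parallel classes of rows of `B` span when `B` has a left inverse. -/
lemma span_row_representatives {n e : Type*} [Fintype n] [Fintype e] [DecidableEq e]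
    {B : Matrix n e ℤ} {T : Matrix e n ℤ} (h : T * B = 1) :
    ⊤ ≤ Submodule.span ℚ
      (Set.range fun (q : Quotient (rowSetoid B)) (t : e) => (B q.out t : ℚ)) := by
  intro v _
  have h' := congrArg (fun M => M.map (Int.castRingHom ℚ)) h
  simp only [Matrix.map_mul,
    Matrix.map_one _ (map_zero (Int.castRingHom ℚ)) (map_one (Int.castRingHom ℚ))] at h'
  have hv := Matrix.vecMul_one v
  rw [← h', ← Matrix.vecMul_vecMul, Matrix.vecMul_eq_sum] at hv
  rw [← hv]
  refine Submodule.sum_mem _ fun i _ => Submodule.smul_mem _ _ ?_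
  obtain ⟨c, -, hc⟩ := (rowSetoid B).symm (Quotient.mk_out i)
  have hrow : B.map (Int.castRingHom ℚ) i =
      c • fun t => (B (Quotient.mk (rowSetoid B) i).out t : ℚ) := by
    ext t
    simpa using hc t
  rw [hrow]
  exact Submodule.smul_mem _ _ (Submodule.subset_span ⟨_, rfl⟩)

/-- A form `∑ᵢ aᵢ zᵢ wᵢ` over one class with `∑ᵢ aᵢ cᵢ = 0` is generated by the binomials
`cⱼ zᵢ wᵢ - cᵢ zⱼ wⱼ`. -/
lemma sum_monomial_mem_span {n K : Type*} [Field K] (s : Finset n) (a c : n → K)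
    (hc : ∀ i, c i ≠ 0) (hsum : ∑ i ∈ s, a i * c i = 0) (I : Ideal (MvPolynomial (n ⊕ n) K))
    (hI : ∀ i ∈ s, ∀ j ∈ s, monomial (pairExp i) (c j) - monomial (pairExp j) (c i) ∈ I) :
    ∑ i ∈ s, monomial (pairExp i) (a i) ∈ I := by
  rcases s.eq_empty_or_nonempty with rfl | ⟨r, hr⟩
  · simp
  have key : ∑ i ∈ s, monomial (pairExp i) (a i) = ∑ i ∈ s, C (a i / c r) *
      (monomial (pairExp i) (c r) - monomial (pairExp r) (c i)) := by
    have h0 : ∑ i ∈ s, monomial (pairExp r) (a i / c r * c i) = 0 := by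
      rw [← map_sum]
      have : ∑ i ∈ s, a i / c r * c i = 0 := by
        rw [← zero_div (c r), ← hsum, Finset.sum_div]
        exact Finset.sum_congr rfl fun i _ => by ring
      rw [this, map_zero]
    simp only [mul_sub, C_mul_monomial, Finset.sum_sub_distrib, h0, sub_zero]
    exact Finset.sum_congr rfl fun i _ => by rw [div_mul_cancel₀ _ (hc r)]
  rw [key]
  exact I.sum_mem fun i hi => I.mul_mem_left _ (hI i hi r hr)

end GaleCircuit

open GaleCircuit


open MvPolynomial

/-- `Circ(ℬ) = ⟨∑ᵢ a_{ji} zᵢ wᵢ : j⟩` is generated by binomials if and only if the Gale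
dual vectors `b₁,…,bₙ` lie on `n - d` linearly independent lines through the origin. -/
theorem stmt_13 (d e : ℕ) (A : Matrix (Fin d) (Fin (d + e)) ℤ)
    (B : Matrix (Fin (d + e)) (Fin e) ℤ)
    (hA : Function.Surjective A.mulVec)
    (hcomp : ∀ c : Fin e → ℤ, A.mulVec (B.mulVec c) = 0)
    (hker : ∀ v : Fin (d + e) → ℤ, A.mulVec v = 0 → ∃! c : Fin e → ℤ, B.mulVec c = v)
    (hrows : ∀ i : Fin (d + e), (fun k => B i k) ≠ 0) :
    (∃ G : Set (MvPolynomial (Fin (d + e) ⊕ Fin (d + e)) ℂ),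
        (∀ g ∈ G, g.support.card ≤ 2) ∧
        Ideal.span G = Ideal.span (Set.range fun j : Fin d =>
          ∑ i : Fin (d + e), C (A j i : ℂ) * X (Sum.inl i) * X (Sum.inr i))) ↔
      ∃ ℓ : Fin e → Fin e → ℚ, LinearIndependent ℚ ℓ ∧
        ∀ i : Fin (d + e), ∃ (k : Fin e) (c : ℚ),
          (fun t => (B i t : ℚ)) = c • ℓ k := by
  classical
  obtain ⟨S, T, hST, hTB, hAB⟩ := exists_splitting A B hA hcomp hker
  have hgen : (fun j : Fin d => ∑ i : Fin (d + e),
      C (A j i : ℂ) * X (Sum.inl i) * X (Sum.inr i)) =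
      fun j => quadric fun i => (A j i : ℂ) := by
    funext j
    simp only [C_mul_X_mul_X, quadric]
  rw [hgen]
  constructor
  · rintro ⟨G, hG2, hG⟩
    let R : Submodule ℂ (Fin (d + e) → ℂ) :=
      LinearMap.ker (Matrix.vecMulLinear (B.map (Int.castRingHom ℂ)))
    have hAR (j : Fin d) : (fun i => (A j i : ℂ)) ∈ R := by
      rw [LinearMap.mem_ker, Matrix.vecMulLinear_apply]
      ext t
      have := congrFun (congrFun hAB j) t
      rw [Matrix.mul_apply, Matrix.zero_apply] at this
      simp only [Matrix.vecMul, dotProduct, Matrix.map_apply, eq_intCast, Pi.zero_apply]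
      exact_mod_cast this
    have hGR (g) (hg : g ∈ G) := by
      refine coeff_pairExp_mem_of_mem_span R ?_ ?_ (hG ▸ Ideal.subset_span hg)
      · rintro _ ⟨j, rfl⟩ m hm
        exact coeff_quadric_of_degree_lt _ hm
      · rintro _ ⟨j, rfl⟩
        simpa only [coeff_pairExp_quadric] using hAR j
    have hAW (j : Fin d) : (fun i => (A j i : ℂ)) ∈ classwiseRelations B ℂ := by
      have hj : quadric (fun i => (A j i : ℂ)) ∈ Ideal.span G := by
        rw [hG]
        exact Ideal.subset_span ⟨j, rfl⟩
      have := (coeff_pairExp_mem_of_mem_span (classwiseRelations B ℂ)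
        (fun g hg => (hGR g hg).1) (fun g hg => ?_) hj).2
      · simpa only [coeff_pairExp_quadric] using this
      · refine mem_classwiseRelations hrows
          (s := g.support.preimage pairExp pairExp_injective.injOn) ?_ ?_ (hGR g hg).2
        · refine le_trans ?_ (hG2 g hg)
          exact Finset.card_le_card_of_injOn pairExp (fun i hi => by simpa using hi)
            pairExp_injective.injOn
        · intro i hi
          simpa using hi
    have hli := linearIndependent_row_representatives hST hrows hAW
    let b := Module.Basis.mk hli (span_row_representatives hTB)
    let σ : Quotient (rowSetoid B) ≃ Fin e := b.indexEquiv (Pi.basisFun ℚ (Fin e))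
    refine ⟨_, hli.comp σ.symm σ.symm.injective, fun i => ?_⟩
    obtain ⟨c, -, hc⟩ := (rowSetoid B).symm (Quotient.mk_out i)
    refine ⟨σ (Quotient.mk _ i), c, ?_⟩
    ext t
    simpa using hc t
  · rintro ⟨ℓ, hℓ, hB⟩
    choose k c hB using hB
    have hBt (i : Fin (d + e)) (t : Fin e) : (B i t : ℚ) = c i * ℓ (k i) t := congrFun (hB i) t
    have hc (i : Fin (d + e)) : c i ≠ 0 := by
      intro h0
      apply hrows i
      ext t
      have := hBt i t
      rw [h0, zero_mul] at this
      exact_mod_cast this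
    let G : Set (MvPolynomial (Fin (d + e) ⊕ Fin (d + e)) ℂ) :=
      {g | ∃ i j, k i = k j ∧
        g = monomial (pairExp i) (c j : ℂ) - monomial (pairExp j) (c i : ℂ)}
    refine ⟨G, ?_, le_antisymm (Ideal.span_le.mpr ?_) (Ideal.span_le.mpr ?_)⟩
    · rintro _ ⟨i, j, -, rfl⟩
      refine (Finset.card_le_card (support_sub _ _ _)).trans
        ((Finset.card_union_le _ _).trans (add_le_add (b := 1) (d := 1) ?_ ?_)) <;>
      exact (Finset.card_le_card support_monomial_subset).trans (Finset.card_singleton _).le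
    · rintro _ ⟨i, j, hij, rfl⟩
      rw [← quadric_sub_single]
      have h0 : Matrix.vecMul (Pi.single i (c j : ℂ) - Pi.single j (c i : ℂ))
          (B.map (Int.castRingHom ℂ)) = 0 := by
        ext t
        have : (c j * B i t - c i * B j t : ℚ) = 0 := by
          rw [hBt, hBt, hij]
          ring
        simp only [Matrix.sub_vecMul, Matrix.single_vecMul, Pi.sub_apply, Pi.smul_apply,
          Matrix.row_apply, Matrix.map_apply, eq_intCast, smul_eq_mul, Pi.zero_apply]
        exact_mod_cast this
      rw [← eq_vecMul_of_vecMul_eq_zero hST h0, quadric_vecMul]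
      exact Ideal.sum_mem _ fun j _ => Ideal.mul_mem_left _ _ (Ideal.subset_span ⟨j, rfl⟩)
    · rintro _ ⟨j, rfl⟩
      have hclass (κ : Fin e) : ∑ i with k i = κ, (A j i : ℚ) * c i = 0 := by
        refine Fintype.linearIndependent_iff.mp hℓ
          (fun κ => ∑ i with k i = κ, (A j i : ℚ) * c i) ?_ κ
        ext t
        have hjt := congrFun (congrFun hAB j) t
        rw [Matrix.mul_apply] at hjt
        have hjt' : ∑ i, (A j i : ℚ) * B i t = 0 := by exact_mod_cast hjt
        rw [← Finset.sum_fiberwise (s := Finset.univ) (g := k)] at hjt'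
        simp only [Finset.sum_apply, Pi.smul_apply, smul_eq_mul, Pi.zero_apply, Finset.sum_mul]
        rw [← hjt']
        refine Finset.sum_congr rfl fun κ _ => Finset.sum_congr rfl fun i hi => ?_
        rw [hBt, (Finset.mem_filter.mp hi).2, mul_assoc]
      simp only [quadric]
      rw [← Finset.sum_fiberwise (s := Finset.univ) (g := k)]
      refine Ideal.sum_mem _ fun κ _ => sum_monomial_mem_span _ _ (fun i => (c i : ℂ))
        (fun i => by exact_mod_cast hc i) (by exact_mod_cast hclass κ) _ fun i hi l hl => ?_
      exact Ideal.subset_span ⟨i, l,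
        (Finset.mem_filter.mp hi).2.trans (Finset.mem_filter.mp hl).2.symm, rfl⟩
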